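/- (Contiguous relation (35), stated with the variable factors needed for its validity.) Let n ≥ 1, let a, b_1,…,b_n, c_1,…,c_n be real with no c_k a nonpositive integer, and let z_1,…,z_n be real with |z_1|+⋯+|z_n| < 1. Then Σ_{i=1}^n (b_i z_i / c_i) · F_A^(n)(a+1; b_1,…,b_{i−1}, b_i+1, b_{i+1},…,b_n; c_1,…,c_{i−1}, c_i+1, c_{i+1},…,c_n; z) = F_A^(n)(a+1; b_1,…,b_n; c_1,…,c_n; z) − F_A^(n)(a; b_1,…,b_n; c_1,…,c_n; z). -/

import Mathlib

open Finset Real Filter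

/-- Pochhammer symbol `(μ)_p = μ(μ+1)⋯(μ+p−1)`. -/
noncomputable def poch (μ : ℝ) (p : ℕ) : ℝ := (ascPochhammer ℝ p).eval μ

/-- `x` is not a nonpositive integer. -/
def NotNonposInt (x : ℝ) : Prop := ∀ j : ℕ, x ≠ -(j : ℝ)

/-- Gauss hypergeometric series `F(a,b;c;z) = Σ_p (a)_p (b)_p z^p / (p! (c)_p)`. -/
noncomputable def gaussF (a b c z : ℝ) : ℝ :=
  ∑' p : ℕ, poch a p * poch b p / ((Nat.factorial p : ℝ) * poch c p) * z ^ p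

/-- General term of the Lauricella hypergeometric series `F_A^(n)`. -/
noncomputable def lauricellaTerm {n : ℕ} (a : ℝ) (b c z : Fin n → ℝ) (p : Fin n → ℕ) : ℝ :=
  poch a (∑ k, p k) *
    ∏ k, poch (b k) (p k) / poch (c k) (p k) * z k ^ p k / (Nat.factorial (p k) : ℝ)

/-- Lauricella hypergeometric series `F_A^(n)(a; b; c; z)`. -/
noncomputable def lauricella {n : ℕ} (a : ℝ) (b c z : Fin n → ℝ) : ℝ :=
  ∑' p : Fin n → ℕ, lauricellaTerm a b c z p

lemma poch_succ (μ : ℝ) (p : ℕ) : poch μ (p + 1) = poch μ p * (μ + p) :=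
  ascPochhammer_succ_eval p μ

lemma poch_succ_left (μ : ℝ) (p : ℕ) : poch μ (p + 1) = μ * poch (μ + 1) p := by
  simp [poch, ascPochhammer_succ_left, Polynomial.eval_comp]

lemma poch_one_left (p : ℕ) : poch 1 p = p.factorial := by
  simp [poch, ascPochhammer_eval_one]

/-- The quotient `(b)_m / (c)_m` grows more slowly than any geometric sequence of ratio `> 1`. -/
lemma exists_abs_poch_div_poch_le (b c : ℝ) {ρ : ℝ} (hρ : 1 < ρ) :
    ∃ C : ℝ, 0 ≤ C ∧ ∀ m : ℕ, |poch b m / poch c m| ≤ C * ρ ^ m := by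
  have hρ0 : 0 < ρ := zero_lt_one.trans hρ
  have hlim : Tendsto (fun m : ℕ => |(b + m) / (c + m)| / ρ) atTop (nhds (1 / ρ)) := by
    have h : Tendsto (fun m : ℕ => (b + m * 1) / (c + m * 1)) atTop (nhds (1 / 1 : ℝ)) := by
      simpa [mul_comm, add_comm] using
        tendsto_add_mul_div_add_mul_atTop_nhds b c (1 : ℝ) one_ne_zero
    simpa using h.abs.div_const ρ
  obtain ⟨r, hr, hr1⟩ := exists_between ((div_lt_one hρ0).2 hρ)
  have hsum : Summable (fun m : ℕ => poch b m / poch c m / ρ ^ m) := by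
    refine summable_of_ratio_norm_eventually_le hr1 ?_
    filter_upwards [hlim.eventually_lt_const hr] with m hm
    have : poch b (m + 1) / poch c (m + 1) / ρ ^ (m + 1) =
        ((b + m) / (c + m) / ρ) * (poch b m / poch c m / ρ ^ m) := by
      rw [poch_succ, poch_succ, pow_succ, mul_div_mul_comm, mul_div_mul_comm, mul_comm]
    rw [this, norm_mul]
    refine mul_le_mul_of_nonneg_right ?_ (norm_nonneg _)
    rw [norm_div, Real.norm_eq_abs, Real.norm_of_nonneg hρ0.le]
    exact hm.le
  refine ⟨∑' m : ℕ, ‖poch b m / poch c m / ρ ^ m‖, tsum_nonneg fun _ => norm_nonneg _,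
    fun m => ?_⟩
  have h := hsum.norm.le_tsum m fun _ _ => norm_nonneg _
  rwa [norm_div, Real.norm_of_nonneg (pow_pos hρ0 m).le, div_le_iff₀ (pow_pos hρ0 m),
    Real.norm_eq_abs] at h

/-- The multinomial series `∑ (|p|! / p!) x ^ p` converges for nonnegative `x` of sum `< 1`. -/
lemma summable_multinomial {n : ℕ} {x : Fin n → ℝ} (hx : ∀ k, 0 ≤ x k) (hs : ∑ k, x k < 1) :
    Summable fun p : Fin n → ℕ =>
      ((∑ k, p k).factorial : ℝ) * ∏ k, x k ^ p k / ((p k).factorial : ℝ) := by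
  classical
  have hx0 : 0 ≤ ∑ k, x k := sum_nonneg fun k _ => hx k
  have hnonneg : ∀ p : Fin n → ℕ,
      0 ≤ ((∑ k, p k).factorial : ℝ) * ∏ k, x k ^ p k / ((p k).factorial : ℝ) := fun p =>
    mul_nonneg (Nat.cast_nonneg _) (prod_nonneg fun k _ =>
      div_nonneg (pow_nonneg (hx k) _) (Nat.cast_nonneg _))
  have hlevel : ∀ N : ℕ, ∑ p ∈ piAntidiag (univ : Finset (Fin n)) N,
      ((∑ k, p k).factorial : ℝ) * ∏ k, x k ^ p k / ((p k).factorial : ℝ) =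
        (∑ k, x k) ^ N := by
    intro N
    rw [Finset.sum_pow_eq_sum_piAntidiag]
    refine sum_congr rfl fun p _ => ?_
    have h : (∏ k, ((p k).factorial : ℝ)) * (Nat.multinomial univ p : ℝ) =
        ((∑ k, p k).factorial : ℝ) := by
      exact_mod_cast Nat.multinomial_spec univ p
    have h0 : (∏ k, ((p k).factorial : ℝ)) ≠ 0 :=
      prod_ne_zero_iff.2 fun k _ => Nat.cast_ne_zero.2 (Nat.factorial_ne_zero _)
    rw [prod_div_distrib, ← h]
    field_simp
  refine summable_of_sum_le hnonneg (c := ∑' N : ℕ, (∑ k, x k) ^ N) fun u => ?_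
  calc ∑ p ∈ u, ((∑ k, p k).factorial : ℝ) * ∏ k, x k ^ p k / ((p k).factorial : ℝ)
      ≤ ∑ p ∈ (u.image fun p => ∑ k, p k).biUnion (piAntidiag (univ : Finset (Fin n))),
          ((∑ k, p k).factorial : ℝ) * ∏ k, x k ^ p k / ((p k).factorial : ℝ) := by
        refine sum_le_sum_of_subset_of_nonneg (fun p hp => ?_) fun p _ _ => hnonneg p
        exact mem_biUnion.2 ⟨_, mem_image_of_mem _ hp, by simp [mem_piAntidiag]⟩
    _ = ∑ N ∈ u.image fun p => ∑ k, p k, (∑ k, x k) ^ N := by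
        rw [sum_biUnion]
        · exact sum_congr rfl fun N _ => hlevel N
        · refine fun N _ M _ h => disjoint_left.2 fun p hN hM => h ?_
          exact (mem_piAntidiag.1 hN).1.symm.trans (mem_piAntidiag.1 hM).1
    _ ≤ ∑' N : ℕ, (∑ k, x k) ^ N :=
        (summable_geometric_of_lt_one hx0 hs).sum_le_tsum _ fun _ _ => pow_nonneg hx0 _

lemma summable_lauricellaTerm {n : ℕ} (a : ℝ) (b c z : Fin n → ℝ) (hz : ∑ k, |z k| < 1) :
    Summable (lauricellaTerm a b c z) := by
  obtain ⟨ρ, hρs, hρ⟩ : ∃ ρ : ℝ, ρ * ρ * ∑ k, |z k| < 1 ∧ 1 < ρ := by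
    have hcont : Tendsto (fun ρ : ℝ => ρ * ρ * ∑ k, |z k|) (nhds 1)
        (nhds (1 * 1 * ∑ k, |z k|)) :=
      Continuous.tendsto (by fun_prop) 1
    have hev := (hcont.mono_left (nhdsWithin_le_nhds (s := Set.Ioi 1))).eventually_lt_const
      (show 1 * 1 * ∑ k, |z k| < 1 by simpa using hz)
    exact (hev.and (self_mem_nhdsWithin : Set.Ioi (1 : ℝ) ∈ nhdsWithin 1 (Set.Ioi 1))).exists
  obtain ⟨A, -, hA⟩ := exists_abs_poch_div_poch_le a 1 hρ
  choose C hC0 hC using fun k => exists_abs_poch_div_poch_le (b k) (c k) hρ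
  have hρ0 : 0 ≤ ρ := zero_le_one.trans hρ.le
  have hmul := (summable_multinomial (x := fun k => ρ * ρ * |z k|)
    (fun k => mul_nonneg (mul_nonneg hρ0 hρ0) (abs_nonneg _))
    (by rwa [← mul_sum])).mul_left (A * ∏ k, C k)
  refine hmul.of_norm_bounded fun p => ?_
  have ha : |poch a (∑ k, p k)| ≤ A * ρ ^ (∑ k, p k) * ((∑ k, p k).factorial : ℝ) := by
    have h := hA (∑ k, p k)
    rwa [poch_one_left, abs_div, Nat.abs_cast,
      div_le_iff₀ (Nat.cast_pos.2 (Nat.factorial_pos _))] at h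
  have hprod : |∏ k, poch (b k) (p k) / poch (c k) (p k) * z k ^ p k /
      (Nat.factorial (p k) : ℝ)| ≤
        ∏ k, C k * ρ ^ p k * |z k| ^ p k / (Nat.factorial (p k) : ℝ) := by
    rw [abs_prod]
    refine prod_le_prod (fun _ _ => abs_nonneg _) fun k _ => ?_
    rw [abs_div, abs_mul, abs_pow, Nat.abs_cast]
    gcongr
    exact hC k (p k)
  rw [lauricellaTerm, Real.norm_eq_abs, abs_mul]
  refine (mul_le_mul ha hprod (abs_nonneg _) ((abs_nonneg _).trans ha)).trans_eq ?_
  have hsplit : ∏ k, (ρ * ρ * |z k|) ^ p k / (Nat.factorial (p k) : ℝ) =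
      ρ ^ (∑ k, p k) * ∏ k, ρ ^ p k * |z k| ^ p k / (Nat.factorial (p k) : ℝ) := by
    rw [← prod_pow_eq_pow_sum, ← prod_mul_distrib]
    exact prod_congr rfl fun k _ => by rw [mul_pow, mul_pow]; ring
  have hconst : ∏ k, C k * ρ ^ p k * |z k| ^ p k / (Nat.factorial (p k) : ℝ) =
      (∏ k, C k) * ∏ k, ρ ^ p k * |z k| ^ p k / (Nat.factorial (p k) : ℝ) := by
    rw [← prod_mul_distrib]
    exact prod_congr rfl fun k _ => by ring
  rw [hsplit, hconst]
  ring

lemma poch_add_one_sub_poch (a : ℝ) (N : ℕ) :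
    poch (a + 1) N - poch a N = N * poch (a + 1) (N - 1) := by
  cases N with
  | zero => simp [poch]
  | succ N =>
    rw [poch_succ (a + 1), poch_succ_left a, Nat.add_sub_cancel]
    push_cast
    ring

/-- The summand of `lauricellaTerm (a + 1) b c z p - lauricellaTerm a b c z p` that comes from
the index `i`. -/
noncomputable def contiguousPart {n : ℕ} (a : ℝ) (b c z : Fin n → ℝ) (i : Fin n)
    (p : Fin n → ℕ) : ℝ :=
  (p i : ℝ) * (poch (a + 1) (∑ k, p k - 1) *
    ∏ k, poch (b k) (p k) / poch (c k) (p k) * z k ^ p k / (Nat.factorial (p k) : ℝ))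

lemma lauricellaTerm_add_one_sub {n : ℕ} (a : ℝ) (b c z : Fin n → ℝ) (p : Fin n → ℕ) :
    lauricellaTerm (a + 1) b c z p - lauricellaTerm a b c z p =
      ∑ i, contiguousPart a b c z i p := by
  simp only [contiguousPart]
  rw [lauricellaTerm, lauricellaTerm, ← sub_mul, poch_add_one_sub_poch, ← sum_mul]
  push_cast
  ring

lemma mul_lauricellaTerm_shift {n : ℕ} (a : ℝ) (b c z : Fin n → ℝ) (i : Fin n)
    (q : Fin n → ℕ) :
    b i * z i / c i * lauricellaTerm (a + 1) (fun j => b j + if j = i then 1 else 0)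
        (fun j => c j + if j = i then 1 else 0) z q =
      contiguousPart a b c z i (q + Pi.single i 1) := by
  have hsum : ∑ k, (q + Pi.single i 1 : Fin n → ℕ) k - 1 = ∑ k, q k := by
    simp [sum_add_distrib]
  rw [contiguousPart, hsum, lauricellaTerm, ← mul_prod_erase univ _ (mem_univ i),
    ← mul_prod_erase univ _ (mem_univ i)]
  have hrest : ∏ k ∈ univ.erase i, poch (b k + if k = i then 1 else 0) (q k) /
        poch (c k + if k = i then 1 else 0) (q k) * z k ^ q k / (Nat.factorial (q k) : ℝ) =
      ∏ k ∈ univ.erase i, poch (b k) ((q + Pi.single i 1 : Fin n → ℕ) k) /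
        poch (c k) ((q + Pi.single i 1 : Fin n → ℕ) k) *
          z k ^ (q + Pi.single i 1 : Fin n → ℕ) k /
            (Nat.factorial ((q + Pi.single i 1 : Fin n → ℕ) k) : ℝ) := by
    refine prod_congr rfl fun k hk => ?_
    simp [ne_of_mem_erase hk]
  rw [hrest]
  simp only [Pi.add_apply, Pi.single_eq_same, if_true, poch_succ_left, Nat.factorial_succ,
    pow_succ]
  have h1 : ((q i + 1 : ℕ) : ℝ) ≠ 0 := Nat.cast_ne_zero.2 (Nat.succ_ne_zero _)
  have h2 : ((q i).factorial : ℝ) ≠ 0 := Nat.cast_ne_zero.2 (Nat.factorial_ne_zero _)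
  rw [Nat.cast_mul, mul_div_mul_comm (b i)]
  field_simp

/-- Reindexing of a series over multi-indices whose terms vanish at `p i = 0`. -/
lemma hasSum_of_hasSum_add_single {n : ℕ} (i : Fin n) {f : (Fin n → ℕ) → ℝ} {s : ℝ}
    (hf : ∀ p, p i = 0 → f p = 0) (h : HasSum (fun q : Fin n → ℕ => f (q + Pi.single i 1)) s) :
    HasSum f s := by
  have hinj : Function.Injective fun q : Fin n → ℕ => q + Pi.single i 1 :=
    add_left_injective _
  refine (hinj.hasSum_iff fun p hp => hf p ?_).1 h
  by_contra hpi
  refine hp ⟨p - Pi.single i 1, ?_⟩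
  funext k
  rcases eq_or_ne k i with rfl | hk
  · simp only [Pi.add_apply, Pi.sub_apply, Pi.single_eq_same]
    omega
  · simp [hk]

/-- formula (35): the contiguous relation
`Σ_i (b_i z_i / c_i) F_A(a+1; …, b_i+1, …; …, c_i+1, …; z)
  = F_A(a+1; b; c; z) − F_A(a; b; c; z)`. -/
theorem lauricella_contiguous (n : ℕ) (hn : 1 ≤ n) (a : ℝ) (b c : Fin n → ℝ)
    (hc : ∀ k, NotNonposInt (c k)) (z : Fin n → ℝ) (hz : ∑ k, |z k| < 1) :
    ∑ i, b i * z i / c i *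
        lauricella (a + 1) (fun j => b j + if j = i then 1 else 0)
          (fun j => c j + if j = i then 1 else 0) z =
      lauricella (a + 1) b c z - lauricella a b c z := by
  have hleft := hasSum_sum fun i (_ : i ∈ univ) =>
    hasSum_of_hasSum_add_single i (f := contiguousPart a b c z i)
      (fun p hp => by simp [contiguousPart, hp])
      (by
        simpa only [mul_lauricellaTerm_shift] using
          (summable_lauricellaTerm (a + 1) (fun j => b j + if j = i then 1 else 0)
            (fun j => c j + if j = i then 1 else 0) z hz).hasSum.mul_left (b i * z i / c i))
  have hright := (summable_lauricellaTerm (a + 1) b c z hz).hasSum.sub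
    (summable_lauricellaTerm a b c z hz).hasSum
  simp only [lauricellaTerm_add_one_sub] at hright
  exact hleft.unique hright
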